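/- There is an absolute constant C > 0 such that, for every integer m ≥ 2, every t > 0 and every s ∈ (0,1), the Richardson coefficients satisfy Σ_{j=1}^m |b_j| ≤ C · log m. -/

import Mathlib

/-- `K = max{m/π, 2t/s}`. -/
noncomputable def Kval (m : ℕ) (t s : ℝ) : ℝ := max ((m : ℝ) / Real.pi) (2 * t / s)

/-- `r_j = ⌈K / sin²(π(2j−1)/(8m))⌉` for `j ∈ {1,…,m}`. -/
noncomputable def rval (m : ℕ) (t s : ℝ) (j : ℕ) : ℕ :=
  ⌈Kval m t s / Real.sin (Real.pi * (2 * (j : ℝ) - 1) / (8 * (m : ℝ))) ^ 2⌉₊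

/-- The sample point `s_j = t / r_j`. -/
noncomputable def sval (m : ℕ) (t s : ℝ) (j : ℕ) : ℝ := t / (rval m t s j : ℝ)

/-- The Richardson coefficient `b_j = ∏_{ℓ ∈ {1,…,m}, ℓ≠j} 1/(1 − r_ℓ/r_j)`. -/
noncomputable def bval (m : ℕ) (t s : ℝ) (j : ℕ) : ℝ :=
  ∏ l ∈ (Finset.Icc 1 m).erase j, (1 - (rval m t s l : ℝ) / (rval m t s j : ℝ))⁻¹

open Polynomial in
lemma cheb_prod (m : ℕ) (hm : 1 ≤ m) (c ψ : ℕ → ℝ)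
    (hψ : ∀ l, ψ l = Real.pi * (2 * (l : ℝ) - 1) / (2 * (m : ℝ)))
    (hc : ∀ l, c l = Real.cos (ψ l)) (j : ℕ) (hj : j ∈ Finset.Icc 1 m) :
    ∏ l ∈ (Finset.Icc 1 m).erase j, ((1 - c l) / |c j - c l|)
      = Real.sin (ψ j) / (m * (1 - c j)) := by
  have hm0 : (0:ℝ) < m := by exact_mod_cast hm
  have hpi := Real.pi_pos
  have hψpos : ∀ l ∈ Finset.Icc 1 m, 0 < ψ l ∧ ψ l < Real.pi := by
    intro l hl
    rw [Finset.mem_Icc] at hl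
    have h1 : (1:ℝ) ≤ l := by exact_mod_cast hl.1
    have h2 : (l:ℝ) ≤ m := by exact_mod_cast hl.2
    rw [hψ]
    refine ⟨by apply div_pos <;> nlinarith, ?_⟩
    rw [div_lt_iff₀ (by positivity)]
    nlinarith
  have hinj : Set.InjOn c (Finset.Icc 1 m : Finset ℕ) := by
    intro a ha b hb hab
    rw [hc, hc] at hab
    have := Real.injOn_cos ⟨(hψpos a ha).1.le, (hψpos a ha).2.le⟩
      ⟨(hψpos b hb).1.le, (hψpos b hb).2.le⟩ hab
    rw [hψ, hψ] at this
    field_simp at this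
    have h2 : (a:ℝ) = b := by linarith
    exact_mod_cast h2
  have hroots : (Chebyshev.T ℝ m).roots = ((Finset.Icc 1 m).image c).val := by
    rw [Chebyshev.roots_T_real]
    congr 1
    ext x
    simp only [Finset.mem_image, Finset.mem_range, Finset.mem_Icc]
    constructor
    · rintro ⟨k, hk, rfl⟩
      refine ⟨k + 1, ⟨by omega, by omega⟩, ?_⟩
      rw [hc, hψ]; push_cast; congr 1; ring
    · rintro ⟨k, hk, rfl⟩
      refine ⟨k - 1, by omega, ?_⟩
      rw [hc, hψ, Nat.cast_sub hk.1]; push_cast; congr 1; ring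
  obtain ⟨a, ha⟩ : ∃ a : ℝ, Chebyshev.T ℝ m = C a * Lagrange.nodal (Finset.Icc 1 m) c := by
    refine ⟨(Chebyshev.T ℝ m).leadingCoeff, ?_⟩
    have hcard : (Chebyshev.T ℝ m).roots.card = (Chebyshev.T ℝ m).natDegree := by
      rw [hroots, Finset.card_val, Finset.card_image_of_injOn hinj]
      simp
    conv_lhs => rw [← C_leadingCoeff_mul_prod_multiset_X_sub_C hcard]
    rw [hroots, Lagrange.nodal]
    congr 1
    rw [← Finset.prod_image (s := Finset.Icc 1 m) (g := c) (f := fun x => X - C x) hinj]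
    rfl
  have e1 : a * ((1 - c j) * ∏ l ∈ (Finset.Icc 1 m).erase j, (1 - c l)) = 1 := by
    have := congrArg (eval 1) ha
    rw [Chebyshev.T_eval_one, eval_mul, eval_C, Lagrange.eval_nodal,
      ← Finset.mul_prod_erase _ _ hj] at this
    exact this.symm
  have e2 : a * ∏ l ∈ (Finset.Icc 1 m).erase j, (c j - c l)
      = m * (Chebyshev.U ℝ ((m:ℤ) - 1)).eval (c j) := by
    have := congrArg (fun p => eval (c j) (derivative p)) ha
    simp only [Chebyshev.T_derivative_eq_U, derivative_C_mul, eval_mul, eval_C] at this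
    rw [Lagrange.eval_nodal_derivative_eval_node_eq hj, Lagrange.eval_nodal] at this
    simpa using this.symm
  have e3 : |Real.sin (m * ψ j)| = 1 := by
    have h0 : Real.cos (m * ψ j) = 0 := by
      have h : (Chebyshev.T ℝ m).eval (c j) = 0 := by
        rw [ha, eval_mul, Lagrange.eval_nodal_at_node hj, mul_zero]
      rw [hc, Chebyshev.T_real_cos] at h
      exact_mod_cast h
    have := Real.sin_sq_add_cos_sq (m * ψ j)
    rw [h0] at this
    have h2 : |Real.sin (m * ψ j)| ^ 2 = 1 := by rw [sq_abs]; linarith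
    nlinarith [abs_nonneg (Real.sin (m * ψ j))]
  have e4 : (Chebyshev.U ℝ ((m:ℤ) - 1)).eval (c j) * Real.sin (ψ j) = Real.sin (m * ψ j) := by
    rw [hc, Chebyshev.U_real_cos]; push_cast; congr 1; ring
  have hlt : ∀ l ∈ Finset.Icc 1 m, 0 < 1 - c l := by
    intro l hl
    have := Real.cos_lt_cos_of_nonneg_of_le_pi le_rfl (hψpos l hl).2.le (hψpos l hl).1
    rw [Real.cos_zero] at this
    rw [hc]; linarith
  have hs : 0 < Real.sin (ψ j) := Real.sin_pos_of_pos_of_lt_pi (hψpos j hj).1 (hψpos j hj).2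
  have hP1 : 0 < ∏ l ∈ (Finset.Icc 1 m).erase j, (1 - c l) :=
    Finset.prod_pos fun l hl => hlt l (Finset.mem_of_mem_erase hl)
  have hP2 : 0 < ∏ l ∈ (Finset.Icc 1 m).erase j, |c j - c l| := by
    refine Finset.prod_pos fun l hl => abs_pos.mpr ?_
    intro h
    exact (Finset.ne_of_mem_erase hl) (hinj (Finset.mem_of_mem_erase hl) hj (by linarith))
  have hcj := hlt j hj
  rw [Finset.prod_div_distrib]
  have hapos : 0 < a := by
    by_contra h
    have : 0 < (1 - c j) * ∏ l ∈ (Finset.Icc 1 m).erase j, (1 - c l) := by positivity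
    nlinarith
  have e5 : a * (∏ l ∈ (Finset.Icc 1 m).erase j, |c j - c l|) * Real.sin (ψ j) = m := by
    have : |a * (∏ l ∈ (Finset.Icc 1 m).erase j, (c j - c l)) * Real.sin (ψ j)| = m := by
      rw [e2, mul_assoc, e4, abs_mul, e3, mul_one, abs_of_pos hm0]
    rwa [abs_mul, abs_mul, Finset.abs_prod, abs_of_pos hs, abs_of_pos hapos] at this
  rw [div_eq_div_iff hP2.ne' (by positivity)]
  have := hapos.ne'
  apply mul_left_cancel₀ this
  calc _ = (a * ((1 - c j) * ∏ l ∈ (Finset.Icc 1 m).erase j, (1 - c l))) * m := by ring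
    _ = m := by rw [e1, one_mul]
    _ = _ := by rw [← e5]; ring

lemma ceil_diff (A B : ℝ) (hA : 0 ≤ A) (hB : 0 ≤ B) (h : 1 ≤ |A - B|) :
    1 ≤ |(⌈A⌉₊ : ℝ) - ⌈B⌉₊| ∧ |A - B| ≤ |(⌈A⌉₊ : ℝ) - ⌈B⌉₊| + 1 := by
  wlog hAB : A ≤ B generalizing A B
  · have := this B A hB hA (by rwa [abs_sub_comm]) (by linarith)
    rwa [abs_sub_comm A B, abs_sub_comm (⌈A⌉₊ : ℝ)]
  rw [abs_sub_comm, abs_of_nonneg (by linarith)] at h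
  have h1 : ⌈A⌉₊ + 1 ≤ ⌈B⌉₊ := by
    rw [← Nat.ceil_add_one hA]; exact Nat.ceil_mono (by linarith)
  have h2 : (⌈A⌉₊ : ℝ) + 1 ≤ ⌈B⌉₊ := by exact_mod_cast h1
  rw [abs_sub_comm A B, abs_sub_comm (⌈A⌉₊ : ℝ), abs_of_nonneg (by linarith),
    abs_of_nonneg (by linarith)]
  have := Nat.ceil_lt_add_one hA
  have := Nat.le_ceil B
  constructor <;> linarith

lemma trig_D1 (u v : ℝ) (hu : 0 < u) (huv : u < v) (hv : v ≤ Real.pi / 4) :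
    4 * (v - u) ≤ 1 / Real.sin u ^ 2 - 1 / Real.sin v ^ 2 := by
  have hpi := Real.pi_pos
  have su : 0 < Real.sin u := Real.sin_pos_of_pos_of_lt_pi hu (by linarith)
  have sv : 0 < Real.sin v := Real.sin_pos_of_pos_of_lt_pi (by linarith) (by linarith)
  have sd : 0 < Real.sin (v - u) := Real.sin_pos_of_pos_of_lt_pi (by linarith) (by linarith)
  have cd : 0 < Real.cos (v - u) := Real.cos_pos_of_mem_Ioo ⟨by linarith, by linarith⟩
  have cs : 0 ≤ Real.cos (v + u) := Real.cos_nonneg_of_mem_Icc ⟨by linarith, by linarith⟩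
  have ht : (v - u) * Real.cos (v - u) ≤ Real.sin (v - u) := by
    have := Real.le_tan (x := v - u) (by linarith) (by linarith)
    rw [Real.tan_eq_sin_div_cos, le_div_iff₀ cd] at this
    exact this
  have h1 : 2 * (Real.sin u * Real.sin v) ≤ Real.cos (v - u) := by
    rw [Real.cos_sub]; rw [Real.cos_add] at cs; linarith
  -- sin(u+v) ≥ 2 sin u sin v
  have hcs : ∀ x, 0 < x → x ≤ Real.pi / 4 → Real.sin x ≤ Real.cos x := by
    intro x hx hx'
    rw [← Real.cos_pi_div_two_sub]
    exact Real.cos_le_cos_of_nonneg_of_le_pi hx.le (by linarith) (by linarith)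
  have h2 : 2 * (Real.sin u * Real.sin v) ≤ Real.sin (v + u) := by
    rw [Real.sin_add]
    nlinarith [hcs u hu (by linarith), hcs v (by linarith) hv]
  have h3 : Real.sin v ^ 2 - Real.sin u ^ 2 = Real.sin (v - u) * Real.sin (v + u) := by
    rw [Real.sin_sub, Real.sin_add]
    nlinarith [Real.sin_sq_add_cos_sq u, Real.sin_sq_add_cos_sq v]
  have h4 : 1 / Real.sin u ^ 2 - 1 / Real.sin v ^ 2
      = Real.sin (v - u) * Real.sin (v + u) / (Real.sin u * Real.sin v) ^ 2 := by
    rw [← h3]; field_simp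
  rw [h4, le_div_iff₀ (by positivity)]
  have hp : 0 < Real.sin u * Real.sin v := by positivity
  have h5 : (v - u) * (2 * (Real.sin u * Real.sin v)) ≤ Real.sin (v - u) :=
    le_trans (mul_le_mul_of_nonneg_left h1 (by linarith)) ht
  calc 4 * (v - u) * (Real.sin u * Real.sin v) ^ 2
      = ((v - u) * (2 * (Real.sin u * Real.sin v))) * (2 * (Real.sin u * Real.sin v)) := by ring
    _ ≤ _ := mul_le_mul h5 h2 (by positivity) sd.le

lemma trig_D2 (u v : ℝ) (hu : 0 < u) (hu' : u ≤ Real.pi / 4) (hv0 : 0 < v)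
    (hv : v ≤ Real.pi / 4) :
    (2 / Real.pi) * |u - v| * Real.sin u ^ 2 ≤ |Real.sin u ^ 2 - Real.sin v ^ 2| := by
  have hpi := Real.pi_pos
  have su : 0 < Real.sin u := Real.sin_pos_of_pos_of_lt_pi hu (by linarith)
  have h3 : Real.sin u ^ 2 - Real.sin v ^ 2 = Real.sin (u - v) * Real.sin (u + v) := by
    rw [Real.sin_sub, Real.sin_add]
    nlinarith [Real.sin_sq_add_cos_sq u, Real.sin_sq_add_cos_sq v]
  have h1 : (2 / Real.pi) * |u - v| ≤ |Real.sin (u - v)| :=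
    Real.mul_abs_le_abs_sin (by rw [abs_le]; constructor <;> linarith)
  have h2 : Real.sin u ≤ Real.sin (u + v) :=
    Real.sin_le_sin_of_le_of_le_pi_div_two (by linarith) (by linarith) (by linarith)
  have h4 : Real.sin u ^ 2 ≤ Real.sin u := by nlinarith [Real.sin_le_one u]
  rw [h3, abs_mul]
  exact mul_le_mul h1 (by rw [abs_of_nonneg (by linarith)]; linarith) (by positivity)
    (abs_nonneg _)

lemma factor_main (K a b : ℝ) (hK0 : 0 < K) (hab : 0 < |a - b|) (pu : 0 < a) (pv : 0 < b)
    (hau : a ≤ 1 / 2) (hav : b ≤ 1 / 2) (hDab : |K / b - K / a| = K * |a - b| / (a * b)) :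
    K / b * |K / b - K / a|⁻¹ ≤
      (1 - (2 * (1 - 2 * a) ^ 2 - 1)) / |(2 * (1 - 2 * b) ^ 2 - 1) - (2 * (1 - 2 * a) ^ 2 - 1)| *
        Real.exp (-b) := by
  have h1 : K / b * |K / b - K / a|⁻¹ = a / |a - b| := by
    rw [hDab]; field_simp
  have h0 : 0 < 1 - a - b := by
    rcases lt_or_ge a (1/2) with h | h
    · linarith
    · rcases lt_or_ge b (1/2) with h' | h'
      · linarith
      · exfalso
        have : a - b = 0 := by linarith
        simp [this] at hab
  have h2 : |(2 * (1 - 2 * b) ^ 2 - 1) - (2 * (1 - 2 * a) ^ 2 - 1)| = 8 * |a - b| * (1 - a - b) := by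
    rw [show (2 * (1 - 2 * b) ^ 2 - 1) - (2 * (1 - 2 * a) ^ 2 - 1) = 8 * (a - b) * (1 - a - b) by ring,
      abs_mul, abs_mul, abs_of_pos h0]; norm_num
  rw [h1, h2]
  have h3 := Real.add_one_le_exp (-b)
  have hden : 0 < 8 * |a - b| * (1 - a - b) := by positivity
  have h4 : a / |a - b| = (1 - (2 * (1 - 2 * a) ^ 2 - 1)) / (8 * |a - b| * (1 - a - b)) *
      ((1 - a - b) / (1 - a)) := by
    have h1a : 0 < 1 - a := by linarith
    rw [div_mul_div_comm, div_eq_div_iff hab.ne' (mul_pos hden h1a).ne']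
    ring
  rw [h4]
  apply mul_le_mul_of_nonneg_left
  · refine le_trans ?_ h3
    rw [div_le_iff₀ (by linarith)]
    have : 0 ≤ a * b := by positivity
    linarith
  · apply div_nonneg _ hden.le
    have : 0 ≤ a * (1 - a) := mul_nonneg pu.le (by linarith)
    linarith

set_option maxHeartbeats 1000000 in
lemma factor_bound (m K u v k : ℝ) (hm : 1 ≤ m) (hK : m / Real.pi ≤ K)
    (hu : 0 < u) (hu' : u ≤ Real.pi / 4) (hv0 : 0 < v) (hv : v ≤ Real.pi / 4)
    (hk : 1 ≤ k) (hd : |u - v| = k * Real.pi / (4 * m)) :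
    |(1 - (⌈K / Real.sin u ^ 2⌉₊ : ℝ) / (⌈K / Real.sin v ^ 2⌉₊ : ℝ))⁻¹| ≤
      (1 - Real.cos (4 * u)) / |Real.cos (4 * v) - Real.cos (4 * u)| *
        Real.exp (Real.pi / m + 4 * Real.pi * Real.sin v ^ 2 * k⁻¹ - Real.sin v ^ 2) := by
  have hpi := Real.pi_pos
  have hm0 : 0 < m := by linarith
  have hK0 : 0 < K := lt_of_lt_of_le (by positivity) hK
  have hKm : m ≤ K * Real.pi := by rwa [div_le_iff₀ hpi] at hK
  have su : 0 < Real.sin u := Real.sin_pos_of_pos_of_lt_pi hu (by linarith)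
  have sv : 0 < Real.sin v := Real.sin_pos_of_pos_of_lt_pi hv0 (by linarith)
  have hduv : 0 < |u - v| := by rw [hd]; positivity
  have hne : u ≠ v := by rintro rfl; simp at hduv
  have hD2 := trig_D2 u v hu hu' hv0 hv
  have hD1 : 4 * |u - v| ≤ |1 / Real.sin u ^ 2 - 1 / Real.sin v ^ 2| := by
    rcases lt_or_gt_of_ne hne with h | h
    · rw [abs_sub_comm u v, abs_of_pos (by linarith : 0 < v - u)]
      exact (trig_D1 u v hu h hv).trans (le_abs_self _)
    · rw [abs_of_pos (by linarith : 0 < u - v), abs_sub_comm]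
      exact (trig_D1 v u hv0 h hu').trans (le_abs_self _)
  have cu : Real.cos (4 * u) = 2 * (1 - 2 * Real.sin u ^ 2) ^ 2 - 1 := by
    rw [show 4 * u = 2 * (2 * u) by ring, Real.cos_two_mul, Real.cos_two_mul, Real.cos_sq']; ring
  have cv : Real.cos (4 * v) = 2 * (1 - 2 * Real.sin v ^ 2) ^ 2 - 1 := by
    rw [show 4 * v = 2 * (2 * v) by ring, Real.cos_two_mul, Real.cos_two_mul, Real.cos_sq']; ring
  have half : ∀ x, 0 < x → x ≤ Real.pi / 4 → Real.sin x ^ 2 ≤ 1 / 2 := by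
    intro x hx hx'
    have : 0 ≤ Real.cos (2 * x) := Real.cos_nonneg_of_mem_Icc ⟨by linarith, by linarith⟩
    rw [Real.cos_two_mul, Real.cos_sq'] at this
    linarith
  have hau := half u hu hu'
  have hav := half v hv0 hv
  have pu : 0 < Real.sin u ^ 2 := by positivity
  have pv : 0 < Real.sin v ^ 2 := by positivity
  rw [cu, cv]
  generalize Real.sin u ^ 2 = a at *
  generalize Real.sin v ^ 2 = b at *
  have hab : 0 < |a - b| := lt_of_lt_of_le (by positivity) hD2
  have hA : 0 < K / a := by positivity
  have hB : 0 < K / b := by positivity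
  have hDeq : |K / b - K / a| = K * |1 / a - 1 / b| := by
    rw [← abs_of_pos hK0, ← abs_mul, abs_of_pos hK0, abs_sub_comm]; congr 1; ring
  have hD1' : 1 ≤ |K / b - K / a| := by
    rw [hDeq]
    have h1 : 1 ≤ K * (4 * |u - v|) := by
      rw [hd, show K * (4 * (k * Real.pi / (4 * m))) = (K * Real.pi) * k / m by field_simp,
        le_div_iff₀ hm0]
      nlinarith
    exact h1.trans (mul_le_mul_of_nonneg_left hD1 hK0.le)
  have hDab : |K / b - K / a| = K * |a - b| / (a * b) := by
    have : K / b - K / a = K * (a - b) / (a * b) := by field_simp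
    rw [this, abs_div, abs_mul, abs_of_pos hK0, abs_of_pos (by positivity : 0 < a * b)]
  have hD3 : 2 / |K / b - K / a| ≤ 4 * Real.pi * b * k⁻¹ := by
    rw [hDab, ← div_eq_mul_inv, div_le_div_iff₀ (by positivity) (by linarith),
      mul_div_assoc', le_div_iff₀ (by positivity)]
    rw [hd] at hD2
    have h1 : 2 / Real.pi * (k * Real.pi / (4 * m)) * a = k * a / (2 * m) := by
      field_simp; norm_num
    rw [h1, div_le_iff₀ (by positivity)] at hD2
    have h3 : k * a * m ≤ |a - b| * (2 * m) * (K * Real.pi) :=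
      mul_le_mul hD2 hKm hm0.le (by positivity)
    have h4 : k * a ≤ 2 * |a - b| * (K * Real.pi) := by
      apply le_of_mul_le_mul_right _ hm0; linarith
    have := mul_le_mul_of_nonneg_left h4 (by positivity : 0 ≤ 2 * b)
    linarith
  obtain ⟨hN1, hN2⟩ := ceil_diff (K / b) (K / a) hB.le hA.le hD1'
  have hRle : (⌈K / b⌉₊ : ℝ) ≤ K / b * Real.exp (Real.pi / m) := by
    have h1 := (Nat.ceil_lt_add_one hB.le).le
    have h2 : K / b + 1 = K / b * (b / K + 1) := by field_simp; ring
    have h3 : b / K ≤ Real.pi / m := by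
      rw [div_le_div_iff₀ hK0 hm0]; nlinarith
    have h4 := Real.add_one_le_exp (Real.pi / m)
    calc _ ≤ K / b * (b / K + 1) := by rw [← h2]; exact h1
      _ ≤ _ := mul_le_mul_of_nonneg_left (by linarith) hB.le
  have hRpos : (0:ℝ) < ⌈K / b⌉₊ := by exact_mod_cast Nat.ceil_pos.mpr hB
  generalize (⌈K / b⌉₊ : ℝ) = R at *
  generalize (⌈K / a⌉₊ : ℝ) = Q at *
  have hlhs : |(1 - Q / R)⁻¹| = R * |R - Q|⁻¹ := by
    rw [show 1 - Q / R = (R - Q) / R by field_simp, inv_div, abs_div, abs_of_pos hRpos]; rfl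
  have hNinv : |R - Q|⁻¹ ≤ |K / b - K / a|⁻¹ * Real.exp (4 * Real.pi * b * k⁻¹) := by
    generalize |K / b - K / a| = D at *
    generalize |R - Q| = N at *
    have hD0 : 0 < D := by linarith
    have hN0 : 0 < N := by linarith
    have h1 : N⁻¹ ≤ D⁻¹ * (2 / D + 1) := by
      rw [inv_le_iff_one_le_mul₀ hN0]
      rw [show D⁻¹ * (2 / D + 1) * N = (2 + D) * N / (D * D) by field_simp,
        le_div_iff₀ (by positivity)]
      by_cases h : D ≤ 2
      · nlinarith
      · nlinarith
    refine h1.trans (mul_le_mul_of_nonneg_left ?_ (by positivity))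
    have := Real.add_one_le_exp (4 * Real.pi * b * k⁻¹)
    linarith
  have hmain := factor_main K a b hK0 hab pu pv hau hav hDab
  rw [hlhs]
  calc R * |R - Q|⁻¹ ≤ (K / b * Real.exp (Real.pi / m)) *
        (|K / b - K / a|⁻¹ * Real.exp (4 * Real.pi * b * k⁻¹)) :=
      mul_le_mul hRle hNinv (by positivity) (by positivity)
    _ = (K / b * |K / b - K / a|⁻¹) *
        (Real.exp (Real.pi / m) * Real.exp (4 * Real.pi * b * k⁻¹)) := by ring
    _ ≤ _ := mul_le_mul_of_nonneg_right hmain (by positivity)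
    _ = _ := by
      rw [mul_assoc, ← Real.exp_add, ← Real.exp_add]; congr 2; ring

lemma harm_bound (m : ℕ) : ∑ k ∈ Finset.Icc 1 m, ((k:ℝ))⁻¹ ≤ 1 + Real.log m := by
  have := harmonic_le_one_add_log m
  rw [harmonic_eq_sum_Icc] at this
  push_cast at this
  exact this

lemma dist_sum (m j : ℕ) (hj : j ∈ Finset.Icc 1 m) :
    ∑ l ∈ (Finset.Icc 1 m).erase j, (|(l:ℝ) - j|)⁻¹ ≤ 2 * (1 + Real.log m) := by
  rw [Finset.mem_Icc] at hj
  have hsub : (Finset.Icc 1 m).erase j = Finset.Icc 1 (j-1) ∪ Finset.Icc (j+1) m := by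
    ext x; simp only [Finset.mem_erase, Finset.mem_Icc, Finset.mem_union]; omega
  have hdisj : Disjoint (Finset.Icc 1 (j-1)) (Finset.Icc (j+1) m) := by
    rw [Finset.disjoint_left]; intro x; simp only [Finset.mem_Icc]; omega
  rw [hsub, Finset.sum_union hdisj]
  have hb := harm_bound m
  have h1 : ∑ l ∈ Finset.Icc 1 (j-1), (|(l:ℝ) - j|)⁻¹ ≤ ∑ k ∈ Finset.Icc 1 m, ((k:ℝ))⁻¹ := by
    have : ∑ l ∈ Finset.Icc 1 (j-1), (|(l:ℝ) - j|)⁻¹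
        = ∑ k ∈ (Finset.Icc 1 (j-1)).image (fun l => j - l), ((k:ℝ))⁻¹ := by
      rw [Finset.sum_image]
      · refine Finset.sum_congr rfl fun l hl => ?_
        rw [Finset.mem_Icc] at hl
        have : l ≤ j := by omega
        rw [Nat.cast_sub this, abs_sub_comm, abs_of_nonneg]
        have : (l:ℝ) ≤ j := by exact_mod_cast this
        linarith
      · intro x hx y hy h
        simp only [Finset.coe_Icc, Set.mem_Icc] at hx hy h
        omega
    rw [this]
    apply Finset.sum_le_sum_of_subset_of_nonneg
    · intro x; simp only [Finset.mem_image, Finset.mem_Icc]; rintro ⟨a, ha, rfl⟩; omega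
    · intros; positivity
  have h2 : ∑ l ∈ Finset.Icc (j+1) m, (|(l:ℝ) - j|)⁻¹ ≤ ∑ k ∈ Finset.Icc 1 m, ((k:ℝ))⁻¹ := by
    have : ∑ l ∈ Finset.Icc (j+1) m, (|(l:ℝ) - j|)⁻¹
        = ∑ k ∈ (Finset.Icc (j+1) m).image (fun l => l - j), ((k:ℝ))⁻¹ := by
      rw [Finset.sum_image]
      · refine Finset.sum_congr rfl fun l hl => ?_
        rw [Finset.mem_Icc] at hl
        have : j ≤ l := by omega
        rw [Nat.cast_sub this, abs_of_nonneg]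
        have : (j:ℝ) ≤ l := by exact_mod_cast this
        linarith
      · intro x hx y hy h
        simp only [Finset.coe_Icc, Set.mem_Icc] at hx hy h
        omega
    rw [this]
    apply Finset.sum_le_sum_of_subset_of_nonneg
    · intro x; simp only [Finset.mem_image, Finset.mem_Icc]; rintro ⟨a, ha, rfl⟩; omega
    · intros; positivity
  linarith

lemma log_bound (x A : ℝ) (hx : 0 < x) (hA : 0 < A) : A * Real.log x ≤ x + A * Real.log A := by
  have := Real.log_le_sub_one_of_pos (div_pos hx hA)
  rw [Real.log_div hx.ne' hA.ne'] at this
  have h2 := mul_le_mul_of_nonneg_left this hA.le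
  have h3 : A * (x / A - 1) = x - A := by field_simp
  rw [h3] at h2
  linarith

lemma b_bound : ∃ C : ℝ, 0 < C ∧ ∀ (m : ℕ), 2 ≤ m → ∀ (t s : ℝ), ∀ j ∈ Finset.Icc 1 m,
    |bval m t s j| ≤ C * ((j:ℝ))⁻¹ := by
  have hpi := Real.pi_pos
  set A := 8 * Real.pi with hA
  have hA0 : 0 < A := by positivity
  set B := |A + A * Real.log A + 1| with hB
  refine ⟨2 * Real.exp (Real.pi + B), by positivity, ?_⟩
  intro m hm t s j hj
  have hm2 : (2:ℝ) ≤ m := by exact_mod_cast hm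
  have hm0 : (0:ℝ) < m := by linarith
  set θ : ℕ → ℝ := fun l => Real.pi * (2 * (l : ℝ) - 1) / (8 * (m : ℝ)) with hθ
  have hθb : ∀ l ∈ Finset.Icc 1 m, 0 < θ l ∧ θ l ≤ Real.pi / 4 := by
    intro l hl
    rw [Finset.mem_Icc] at hl
    have h1 : (1:ℝ) ≤ l := by exact_mod_cast hl.1
    have h2 : (l:ℝ) ≤ m := by exact_mod_cast hl.2
    simp only [hθ]
    refine ⟨by apply div_pos <;> nlinarith, ?_⟩
    rw [div_le_iff₀ (by positivity)]
    nlinarith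
  have hcheb := cheb_prod m (by omega) (fun l => Real.cos (4 * θ l)) (fun l => 4 * θ l)
    (by intro l; simp only [hθ]; field_simp; ring) (fun l => rfl) j hj
  set a := Real.sin (θ j) ^ 2 with ha
  have ha0 : 0 ≤ a := by positivity
  have ha1 : a ≤ 1 := Real.sin_sq_le_one _
  have hbnd : |bval m t s j| ≤ ∏ l ∈ (Finset.Icc 1 m).erase j,
      ((1 - Real.cos (4 * θ l)) / |Real.cos (4 * θ j) - Real.cos (4 * θ l)| *
        Real.exp (Real.pi / m + 4 * Real.pi * a * (|(l:ℝ) - j|)⁻¹ - a)) := by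
    rw [bval, Finset.abs_prod]
    refine Finset.prod_le_prod (fun _ _ => abs_nonneg _) fun l hl => ?_
    have hl' := Finset.mem_of_mem_erase hl
    have hlj := Finset.ne_of_mem_erase hl
    refine factor_bound m (Kval m t s) (θ l) (θ j) |(l:ℝ) - j| (by linarith) (le_max_left _ _)
      (hθb l hl').1 (hθb l hl').2 (hθb j hj).1 (hθb j hj).2 ?_ ?_
    · have : (1:ℤ) ≤ |(l:ℤ) - j| := Int.one_le_abs (by omega)
      exact_mod_cast this
    · have : θ l - θ j = ((l:ℝ) - j) * (Real.pi / (4 * m)) := by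
        simp only [hθ]; field_simp; ring
      rw [this, abs_mul, abs_of_pos (by positivity : 0 < Real.pi / (4 * m))]; ring
  rw [Finset.prod_mul_distrib, hcheb, ← Real.exp_sum] at hbnd
  have hexp : ∑ l ∈ (Finset.Icc 1 m).erase j,
      (Real.pi / m + 4 * Real.pi * a * (|(l:ℝ) - j|)⁻¹ - a) ≤ Real.pi + B := by
    rw [Finset.sum_sub_distrib, Finset.sum_add_distrib, ← Finset.mul_sum, Finset.sum_const,
      Finset.sum_const, Finset.card_erase_of_mem hj, Nat.card_Icc, nsmul_eq_mul, nsmul_eq_mul,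
      show m + 1 - 1 - 1 = m - 1 by omega, Nat.cast_sub (by omega)]
    push_cast
    have h1 := dist_sum m j hj
    have h2 := mul_le_mul_of_nonneg_left h1 (by positivity : 0 ≤ 4 * Real.pi * a)
    have h3 := log_bound m A hm0 hA0
    have h4 : ((m:ℝ) - 1) * (Real.pi / m) ≤ Real.pi := by
      rw [mul_div_assoc', div_le_iff₀ hm0]; nlinarith
    have h5 : A * (1 + Real.log m) - (m - 1) ≤ B := le_trans (by linarith) (le_abs_self _)
    have h6 : a * (A * (1 + Real.log m) - (m - 1)) ≤ B := by
      have hB0 : 0 ≤ B := abs_nonneg _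
      nlinarith
    have h7 : 4 * Real.pi * a * (2 * (1 + Real.log m)) = a * (A * (1 + Real.log m)) := by
      rw [hA]; ring
    linarith
  have hfront : Real.sin (4 * θ j) / (m * (1 - Real.cos (4 * θ j))) ≤ 2 * ((j:ℝ))⁻¹ := by
    obtain ⟨h1, h2⟩ := hθb j hj
    have hj1 : (1:ℝ) ≤ j := by rw [Finset.mem_Icc] at hj; exact_mod_cast hj.1
    have hjm : (j:ℝ) ≤ m := by rw [Finset.mem_Icc] at hj; exact_mod_cast hj.2
    have hlt : θ j < Real.pi / 4 := by
      simp only [hθ]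
      rw [div_lt_iff₀ (by positivity)]
      nlinarith
    set x := 2 * θ j with hx
    have e : 4 * θ j = 2 * x := by rw [hx]; ring
    have sx : 0 < Real.sin x := Real.sin_pos_of_pos_of_lt_pi (by linarith) (by linarith)
    have cx : 0 < Real.cos x := Real.cos_pos_of_mem_Ioo ⟨by linarith, by linarith⟩
    have ht : x * Real.cos x ≤ Real.sin x := by
      have := Real.le_tan (x := x) (by linarith) (by linarith)
      rwa [Real.tan_eq_sin_div_cos, le_div_iff₀ cx] at this
    have hxj : (j:ℝ) ≤ 2 * (m * x) := by
      have : 2 * (m * x) = Real.pi * (2 * j - 1) / 2 := by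
        simp only [hx, hθ]; field_simp; ring
      rw [this]
      nlinarith [Real.pi_gt_three]
    clear_value x
    rw [e, Real.sin_two_mul, Real.cos_two_mul x, Real.cos_sq' x, ← div_eq_mul_inv,
      show (m:ℝ) * (1 - (2 * (1 - Real.sin x ^ 2) - 1)) = 2 * m * Real.sin x ^ 2 by ring,
      div_le_div_iff₀ (by positivity) (by positivity)]
    have h8 : Real.cos x * j ≤ 2 * m * Real.sin x := by
      calc Real.cos x * j ≤ Real.cos x * (2 * (m * x)) := mul_le_mul_of_nonneg_left hxj cx.le
        _ = 2 * m * (x * Real.cos x) := by ring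
        _ ≤ _ := mul_le_mul_of_nonneg_left ht (by positivity)
    have := mul_le_mul_of_nonneg_left h8 (by positivity : 0 ≤ 2 * Real.sin x)
    linarith
  calc |bval m t s j| ≤ _ := hbnd
    _ ≤ (2 * ((j:ℝ))⁻¹) * Real.exp (Real.pi + B) :=
      mul_le_mul hfront (Real.exp_le_exp.mpr hexp) (by positivity) (by positivity)
    _ = _ := by ring

/-- there is an absolute constant `C > 0` such that, for every integer `m ≥ 2`,
every `t > 0` and every `s ∈ (0,1)`, the Richardson coefficients satisfy
`Σ_{j=1}^m |b_j| ≤ C·log m`. -/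
theorem stmt10 :
    ∃ C : ℝ, 0 < C ∧ ∀ (m : ℕ), 2 ≤ m → ∀ (t s : ℝ), 0 < t → s ∈ Set.Ioo (0:ℝ) 1 →
      ∑ j ∈ Finset.Icc 1 m, |bval m t s j| ≤ C * Real.log m := by
  obtain ⟨C, hC, h⟩ := b_bound
  refine ⟨3 * C, by positivity, ?_⟩
  intro m hm t s _ _
  have hm2 : (2:ℝ) ≤ m := by exact_mod_cast hm
  have hlog : 1 / 2 ≤ Real.log m := by
    have h1 := Real.log_le_log (by norm_num) hm2
    have := Real.log_two_gt_d9
    linarith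
  calc ∑ j ∈ Finset.Icc 1 m, |bval m t s j| ≤ ∑ j ∈ Finset.Icc 1 m, C * ((j:ℝ))⁻¹ :=
      Finset.sum_le_sum fun j hj => h m hm t s j hj
    _ = C * ∑ j ∈ Finset.Icc 1 m, ((j:ℝ))⁻¹ := by rw [Finset.mul_sum]
    _ ≤ C * (1 + Real.log m) := mul_le_mul_of_nonneg_left (harm_bound m) hC.le
    _ ≤ 3 * C * Real.log m := by nlinarith
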